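/- arXiv:1511.00147 — 2 statements merged into one kernel-verified Lean document; each statement's English description precedes it below -/
import Mathlib

section
/- Let Ω ⊂ ℝ^d be a bounded open domain, let T > 0, c > 0, k > 0, c₀ > 0, and let w₁ : Ω → ℝ satisfy w₁(x) ≥ c₀ d(x) for all x ∈ Ω. Let H : (0,T] × Ω × Ω → ℝ be a nonnegative kernel satisfying H(t,x,y) ≥ c · min(w₁(x)/|x−y|, 1) · min(w₁(y)/|x−y|, 1) · t^{−d/2} e^{−|x−y|²/(kt)} for all 0 < t ≤ T and x, y ∈ Ω. Then there exists a constant c₁ > 0 depending only on d, c, k, c₀ such that ∫_Ω H(t,x,y) dy ≥ c₁ min(1, (d(x)/√t)^d) for all x ∈ Ω and 0 < t ≤ T. -/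
open MeasureTheory Real Set

theorem IsPreconnected.subset_of_disjoint_frontier {X : Type*} [TopologicalSpace X] {s t : Set X}
    (ht : IsPreconnected t) (hs : IsOpen s) (hts : Disjoint t (frontier s))
    (hne : (t ∩ s).Nonempty) : t ⊆ s := by
  refine ht.subset_left_of_subset_union hs isClosed_closure.isOpen_compl
    (disjoint_compl_right.mono_left subset_closure) (fun y hy => ?_) hne
  by_cases hys : y ∈ s
  · exact Or.inl hys
  · refine Or.inr fun hyc => disjoint_left.1 hts hy ?_
    rw [hs.frontier_eq]
    exact ⟨hyc, hys⟩

theorem IsOpen.ball_infDist_frontier_subset {E : Type*} [NormedAddCommGroup E] [NormedSpace ℝ E]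
    {s : Set E} (hs : IsOpen s) {x : E} (hx : x ∈ s) :
    Metric.ball x (Metric.infDist x (frontier s)) ⊆ s := by
  rcases (Metric.infDist_nonneg (x := x) (s := frontier s)).eq_or_lt with h | h
  · simp [← h]
  · exact (convex_ball x _).isPreconnected.subset_of_disjoint_frontier hs
      Metric.disjoint_ball_infDist ⟨x, Metric.mem_ball_self h, hx⟩

/-- Volume of a punctured Euclidean ball in positive dimension. -/
theorem volume_real_ball_sdiff_singleton {d : ℕ} (hd : 1 ≤ d) (x : EuclideanSpace ℝ (Fin d))
    {r : ℝ} (hr : 0 < r) :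
    volume.real (Metric.ball x r \ {x}) =
      r ^ d * volume.real (Metric.ball (0 : EuclideanSpace ℝ (Fin d)) 1) := by
  have : Nonempty (Fin d) := ⟨⟨0, hd⟩⟩
  rw [measureReal_congr (sdiff_null_ae_eq_self (measure_singleton x)), measureReal_def,
    Measure.addHaar_ball_of_pos volume x hr, ENNReal.toReal_mul, finrank_euclideanSpace_fin,
    ENNReal.toReal_ofReal (by positivity), measureReal_def]

theorem min_le_min_div_of_mul_le {a w s : ℝ} (hs : 0 < s) (h : a * s ≤ w) :
    min a 1 ≤ min (w / s) 1 :=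
  min_le_min_right 1 ((le_div_iff₀ hs).2 h)

theorem rpow_neg_natCast_div_two {t : ℝ} (ht : 0 ≤ t) (d : ℕ) :
    t ^ (-(d : ℝ) / 2) = (√t ^ d)⁻¹ := by
  rw [neg_div, Real.rpow_neg ht, Real.sqrt_eq_rpow, ← Real.rpow_mul_natCast ht]
  congr 2
  ring

theorem min_one_div_pow {a b : ℝ} (hb : 0 < b) (n : ℕ) :
    min 1 ((a / b) ^ n) ≤ (min a b / b) ^ n := by
  rcases le_total a b with h | h
  · rw [min_eq_left h]
    exact min_le_right _ _
  · rw [min_eq_right h, div_self hb.ne', one_pow]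
    exact min_le_left _ _

/-- Lower bound for the spatial integral of a kernel satisfying the Dirichlet heat kernel
lower bound: `∫_Ω H(t,x,y) dy ≥ c₁ min(1, (d(x)/√t)^d)`, with `c₁` depending only on
`d`, `c`, `k`, `c₀`. Here `d(x) = dist(x, ∂Ω)`. -/
theorem heat_kernel_mass_lower_bound
    (d : ℕ) (hd : 1 ≤ d) (c k c₀ : ℝ) (hc : 0 < c) (hk : 0 < k) (hc₀ : 0 < c₀) :
    ∃ c₁ > 0, ∀ (Ω : Set (EuclideanSpace ℝ (Fin d))), IsOpen Ω → Bornology.IsBounded Ω →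
      Ω.Nonempty →
      ∀ T : ℝ, 0 < T →
      ∀ w₁ : EuclideanSpace ℝ (Fin d) → ℝ,
        (∀ x ∈ Ω, c₀ * Metric.infDist x (frontier Ω) ≤ w₁ x) →
      ∀ H : ℝ → EuclideanSpace ℝ (Fin d) → EuclideanSpace ℝ (Fin d) → ℝ,
        (∀ t ∈ Ioc (0 : ℝ) T, ∀ x ∈ Ω, ∀ y ∈ Ω, 0 ≤ H t x y) →
        (∀ t ∈ Ioc (0 : ℝ) T, ∀ x ∈ Ω, IntegrableOn (fun y => H t x y) Ω) →
        (∀ t ∈ Ioc (0 : ℝ) T, ∀ x ∈ Ω, ∀ y ∈ Ω,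
          c * min (w₁ x / ‖x - y‖) 1 * min (w₁ y / ‖x - y‖) 1 *
              t ^ (-(d : ℝ) / 2) * Real.exp (-‖x - y‖ ^ 2 / (k * t)) ≤ H t x y) →
      ∀ x ∈ Ω, ∀ t ∈ Ioc (0 : ℝ) T,
        c₁ * min 1 ((Metric.infDist x (frontier Ω) / Real.sqrt t) ^ d) ≤
          ∫ y in Ω, H t x y := by
  have hV : 0 < volume.real (Metric.ball (0 : EuclideanSpace ℝ (Fin d)) 1) :=
    ENNReal.toReal_pos (Metric.measure_ball_pos _ _ one_pos).ne' measure_ball_lt_top.ne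
  set V := volume.real (Metric.ball (0 : EuclideanSpace ℝ (Fin d)) 1)
  set m := min c₀ 1 with hm
  have hm0 : 0 < m := lt_min hc₀ one_pos
  set e := Real.exp (-1 / k) with he
  refine ⟨c * m * m * e * V / 2 ^ d, by positivity, ?_⟩
  intro Ω hΩ _ _ T _ w₁ hw H hH0 hHint hH x hx t ht
  set D := Metric.infDist x (frontier Ω) with hD
  have ht0 : 0 < t := ht.1
  have hst : 0 < √t := Real.sqrt_pos.2 ht0
  have hnonneg : 0 ≤ᵐ[volume.restrict Ω] fun y => H t x y :=
    (ae_restrict_iff' hΩ.measurableSet).2 (ae_of_all _ (hH0 t ht x hx))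
  rcases (Metric.infDist_nonneg (x := x) (s := frontier Ω)).eq_or_lt with h0 | hD0
  · rw [hD, ← h0, zero_div, zero_pow (by omega), min_eq_right zero_le_one, mul_zero]
    exact integral_nonneg_of_ae hnonneg
  rw [← hD] at hD0
  set r := min D √t / 2 with hr
  have hr0 : 0 < r := half_pos (lt_min hD0 hst)
  have hrD : r ≤ D / 2 := div_le_div_of_nonneg_right (min_le_left _ _) zero_le_two
  have hrt : r ≤ √t / 2 := div_le_div_of_nonneg_right (min_le_right _ _) zero_le_two
  have hsub : Metric.ball x r \ {x} ⊆ Ω := sdiff_subset.trans <|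
    (Metric.ball_subset_ball (by linarith)).trans (hΩ.ball_infDist_frontier_subset hx)
  have key : ∀ y ∈ Metric.ball x r \ {x}, c * m * m * (√t ^ d)⁻¹ * e ≤ H t x y := by
    intro y hy
    have hyr : ‖x - y‖ < r := by
      rw [← dist_eq_norm]
      exact Metric.mem_ball'.1 hy.1
    have hpos : 0 < ‖x - y‖ := norm_pos_iff.2 (sub_ne_zero.2 (Ne.symm hy.2))
    have hyD : D ≤ Metric.infDist y (frontier Ω) + ‖x - y‖ := by
      rw [← dist_eq_norm]
      exact Metric.infDist_le_infDist_add_dist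
    refine le_trans ?_ (hH t ht x hx y (hsub hy))
    rw [rpow_neg_natCast_div_two ht0.le]
    have h1 : m ≤ min (w₁ x / ‖x - y‖) 1 := min_le_min_div_of_mul_le hpos <|
      (mul_le_mul_of_nonneg_left (by linarith) hc₀.le).trans (hw x hx)
    have h2 : m ≤ min (w₁ y / ‖x - y‖) 1 := min_le_min_div_of_mul_le hpos <|
      (mul_le_mul_of_nonneg_left (by linarith) hc₀.le).trans (hw y (hsub hy))
    have h3 : e ≤ Real.exp (-‖x - y‖ ^ 2 / (k * t)) := by
      rw [he, Real.exp_le_exp, div_le_div_iff₀ hk (by positivity)]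
      nlinarith [mul_pos hk ht0, Real.sq_sqrt ht0.le,
        mul_le_mul_of_nonneg_left (pow_le_pow_left₀ hpos.le
          (show ‖x - y‖ ≤ √t by linarith) 2) hk.le]
    have h1' := hm0.le.trans h1
    have h2' := hm0.le.trans h2
    gcongr
  calc
    c * m * m * e * V / 2 ^ d * min 1 ((D / √t) ^ d)
      ≤ c * m * m * e * V / 2 ^ d * (min D √t / √t) ^ d := by
        gcongr
        exact min_one_div_pow hst d
    _ = c * m * m * (√t ^ d)⁻¹ * e * volume.real (Metric.ball x r \ {x}) := by
        rw [volume_real_ball_sdiff_singleton hd x hr0, hr, div_pow, div_pow]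
        ring
    _ ≤ ∫ y in Metric.ball x r \ {x}, H t x y :=
        setIntegral_ge_of_const_le_real (measurableSet_ball.diff (measurableSet_singleton x))
          ((measure_mono sdiff_subset).trans_lt measure_ball_lt_top).ne key
          ((hHint t ht x hx).mono_set hsub)
    _ ≤ ∫ y in Ω, H t x y := setIntegral_mono_set (hHint t ht x hx) hnonneg hsub.eventuallyLE
end

section
/- Let d ≥ 1 and let H(x,y,t) = c t^{−d/2} ( e^{−|x−y|²/(4t)} − e^{−|x−ỹ|²/(4t)} ) be the Dirichlet heat kernel of the half space ℝ^d_+, with ỹ = (y', −y_d) and c = (4π)^{−d/2}. Define K(x,y) = ∫₀^∞ t^{−3/2} (∇_x + ∇_y) H(x,y,t) dt. Then there is a constant C > 0 depending only on d such that ∫_{ℝ^d_+} |K(x,y)| dy ≤ C / x_d² for every x ∈ ℝ^d_+. -/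
open MeasureTheory Real Set

noncomputable section

/-- Reflection of the last coordinate: `ỹ = (y', -y_d)`. -/
def reflLast (m : ℕ) (y : EuclideanSpace ℝ (Fin (m + 1))) : EuclideanSpace ℝ (Fin (m + 1)) :=
  y - (2 * y (Fin.last m)) • EuclideanSpace.single (Fin.last m) 1

/-- The Dirichlet heat kernel of the half space `{x : x_d > 0}`, by the method of images. -/
def Hhalf (m : ℕ) (x y : EuclideanSpace ℝ (Fin (m + 1))) (t : ℝ) : ℝ :=
  (4 * Real.pi) ^ (-((m : ℝ) + 1) / 2) * t ^ (-((m : ℝ) + 1) / 2) *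
    (Real.exp (-‖x - y‖ ^ 2 / (4 * t)) - Real.exp (-‖x - reflLast m y‖ ^ 2 / (4 * t)))

/-- The sum of partial derivatives `(∂_{x_i} + ∂_{y_i}) H(x,y,t)`. -/
def pdSum (m : ℕ) (i : Fin (m + 1)) (x y : EuclideanSpace ℝ (Fin (m + 1))) (t : ℝ) : ℝ :=
  fderiv ℝ (fun x' => Hhalf m x' y t) x (EuclideanSpace.single i 1) +
    fderiv ℝ (fun y' => Hhalf m x y' t) y (EuclideanSpace.single i 1)

/-- The `i`-th component of the commutator kernel
`K(x,y) = ∫₀^∞ t^{-3/2} (∇_x + ∇_y) H(x,y,t) dt` on the half space. -/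
def Khalf (m : ℕ) (i : Fin (m + 1)) (x y : EuclideanSpace ℝ (Fin (m + 1))) : ℝ :=
  ∫ t in Ioi (0 : ℝ), t ^ (-(3 : ℝ) / 2) * pdSum m i x y t

/-- The derivative of a Gaussian composed with an affine map. -/
theorem hasFDerivAt_gaussian_comp {E F : Type*} [NormedAddCommGroup E] [NormedSpace ℝ E]
    [NormedAddCommGroup F] [InnerProductSpace ℝ F] {f : E → F} {f' : E →L[ℝ] F} {z : E}
    (hf : HasFDerivAt f f' z) (t : ℝ) :
    HasFDerivAt (fun w => Real.exp (-‖f w‖ ^ 2 / (4 * t)))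
      (Real.exp (-‖f z‖ ^ 2 / (4 * t)) •
        ((4 * t)⁻¹ • (-(2 • (innerSL ℝ (f z)).comp f') : E →L[ℝ] ℝ))) z := by
  simp only [div_eq_mul_inv]
  exact (hf.norm_sq.neg.mul_const ((4 * t)⁻¹)).exp

/-- The reflection in the last coordinate as a continuous linear map. -/
def reflLastCLM (m : ℕ) : EuclideanSpace ℝ (Fin (m + 1)) →L[ℝ] EuclideanSpace ℝ (Fin (m + 1)) :=
  ContinuousLinearMap.id ℝ _ -
    ((2 : ℝ) • (EuclideanSpace.proj (Fin.last m) :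
      EuclideanSpace ℝ (Fin (m + 1)) →L[ℝ] ℝ)).smulRight (EuclideanSpace.single (Fin.last m) 1)

theorem reflLastCLM_apply (m : ℕ) (y : EuclideanSpace ℝ (Fin (m + 1))) :
    reflLastCLM m y = reflLast m y := by
  simp [reflLastCLM, reflLast]

theorem pdSum_eq (m : ℕ) (i : Fin (m + 1)) (x y : EuclideanSpace ℝ (Fin (m + 1))) (t : ℝ) :
    pdSum m i x y t =
      (4 * Real.pi) ^ (-((m : ℝ) + 1) / 2) * t ^ (-((m : ℝ) + 1) / 2) *
        (Real.exp (-‖x - reflLast m y‖ ^ 2 / (4 * t)) *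
          ((4 * t)⁻¹ * (4 * (if i = Fin.last m then x (Fin.last m) + y (Fin.last m) else 0)))) := by
  have hrefl : HasFDerivAt (reflLast m) (reflLastCLM m) y := by
    have h := (reflLastCLM m).hasFDerivAt (x := y)
    rwa [show (reflLastCLM m : _ → _) = reflLast m from funext (reflLastCLM_apply m)] at h
  have hx := ((hasFDerivAt_gaussian_comp ((hasFDerivAt_id x).sub_const y) t).sub
    (hasFDerivAt_gaussian_comp ((hasFDerivAt_id x).sub_const (reflLast m y)) t)).const_mul
      ((4 * Real.pi) ^ (-((m : ℝ) + 1) / 2) * t ^ (-((m : ℝ) + 1) / 2))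
  have hy := ((hasFDerivAt_gaussian_comp ((hasFDerivAt_id y).const_sub x) t).sub
    (hasFDerivAt_gaussian_comp (hrefl.const_sub x) t)).const_mul
      ((4 * Real.pi) ^ (-((m : ℝ) + 1) / 2) * t ^ (-((m : ℝ) + 1) / 2))
  have hx' : fderiv ℝ (fun x' => Hhalf m x' y t) x = _ := hx.fderiv
  have hy' : fderiv ℝ (fun y' => Hhalf m x y' t) y = _ := hy.fderiv
  unfold pdSum
  rw [hx', hy']
  by_cases hi : i = Fin.last m
  · subst hi
    simp [reflLastCLM_apply, reflLast, inner_sub_right, inner_smul_right,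
      EuclideanSpace.inner_single_right]
    ring
  · simp [reflLastCLM_apply, reflLast, EuclideanSpace.inner_single_right, hi, Ne.symm hi]
    ring

/-- Scaling of the time integral of the Gaussian. -/
theorem integral_Ioi_rpow_mul_exp_neg_div (a : ℝ) {R : ℝ} (hR : 0 < R) :
    ∫ t in Ioi (0 : ℝ), t ^ a * Real.exp (-R ^ 2 / (4 * t)) =
      (R ^ 2) ^ (a + 1) * ∫ t in Ioi (0 : ℝ), t ^ a * Real.exp (-1 / (4 * t)) := by
  have hR2 : 0 < R ^ 2 := by positivity
  have h := integral_comp_mul_left_Ioi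
    (fun t : ℝ => t ^ a * Real.exp (-R ^ 2 / (4 * t))) 0 hR2
  rw [mul_zero, smul_eq_mul] at h
  rw [← mul_inv_cancel_left₀ hR2.ne' (∫ t in Ioi (0 : ℝ), t ^ a * Real.exp (-R ^ 2 / (4 * t))),
    ← h, Real.rpow_add_one hR2.ne', mul_comm _ (R ^ 2), mul_assoc, ← integral_const_mul ((R ^ 2) ^ a)]
  congr 1
  refine setIntegral_congr_fun measurableSet_Ioi fun t (ht : 0 < t) => ?_
  rw [Real.mul_rpow hR2.le ht.le, mul_assoc]
  congr 3
  field_simp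

theorem Khalf_eq (m : ℕ) (i : Fin (m + 1)) (x y : EuclideanSpace ℝ (Fin (m + 1)))
    (hR : 0 < ‖x - reflLast m y‖) :
    Khalf m i x y = if i = Fin.last m then
      (4 * Real.pi) ^ (-((m : ℝ) + 1) / 2) * (x (Fin.last m) + y (Fin.last m)) *
        ((‖x - reflLast m y‖ ^ 2) ^ (-((m : ℝ) + 4) / 2) *
        ∫ t in Ioi (0 : ℝ), t ^ (-((m : ℝ) + 6) / 2) * Real.exp (-1 / (4 * t))) else 0 := by
  unfold Khalf
  simp only [pdSum_eq]
  split_ifs with hi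
  · have h := integral_Ioi_rpow_mul_exp_neg_div (-((m : ℝ) + 6) / 2) hR
    rw [show -((m : ℝ) + 6) / 2 + 1 = -((m : ℝ) + 4) / 2 by ring] at h
    rw [← h, ← integral_const_mul]
    refine setIntegral_congr_fun measurableSet_Ioi fun t (ht : 0 < t) => ?_
    rw [show -((m : ℝ) + 6) / 2 = -(3 : ℝ) / 2 + -((m : ℝ) + 1) / 2 + -1 by ring,
      Real.rpow_add ht, Real.rpow_add ht, Real.rpow_neg_one, mul_inv]
    ring
  · simp

theorem norm_sub_reflLast_sq (m : ℕ) (x y : EuclideanSpace ℝ (Fin (m + 1))) :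
    ‖x - reflLast m y‖ ^ 2 = ‖x - y‖ ^ 2 + 4 * x (Fin.last m) * y (Fin.last m) := by
  have h : x - reflLast m y =
      (x - y) + (2 * y (Fin.last m)) • EuclideanSpace.single (Fin.last m) (1 : ℝ) := by
    simp only [reflLast]; abel
  rw [h, norm_add_sq_real, inner_smul_right, EuclideanSpace.inner_single_right, norm_smul]
  simp [mul_pow]
  ring

theorem add_le_norm_sub_reflLast (m : ℕ) (x y : EuclideanSpace ℝ (Fin (m + 1))) :
    x (Fin.last m) + y (Fin.last m) ≤ ‖x - reflLast m y‖ := by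
  have h := PiLp.norm_apply_le (x - reflLast m y) (Fin.last m)
  refine le_trans (le_of_eq ?_) ((le_abs_self _).trans h)
  simp [reflLast]
  ring

/-- Pointwise bound of the kernel by a rescaled integrable profile. -/
theorem sqrt_sum_Khalf_sq_le (m : ℕ) (x y : EuclideanSpace ℝ (Fin (m + 1)))
    (hx : 0 < x (Fin.last m)) (hy : 0 < y (Fin.last m)) :
    Real.sqrt (∑ i, (Khalf m i x y) ^ 2) ≤
      (4 * Real.pi) ^ (-((m : ℝ) + 1) / 2) *
        (∫ t in Ioi (0 : ℝ), t ^ (-((m : ℝ) + 6) / 2) * Real.exp (-1 / (4 * t))) *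
        (x (Fin.last m) / 2) ^ (-((m : ℝ) + 3)) *
        (1 + ‖(x (Fin.last m))⁻¹ • (y - x)‖) ^ (-((m : ℝ) + 3)) := by
  set I := ∫ t in Ioi (0 : ℝ), t ^ (-((m : ℝ) + 6) / 2) * Real.exp (-1 / (4 * t)) with hI
  have hI0 : 0 ≤ I := setIntegral_nonneg measurableSet_Ioi fun t (ht : 0 < t) => by positivity
  have hs := add_le_norm_sub_reflLast m x y
  have hR : 0 < ‖x - reflLast m y‖ := by linarith
  have hsq := norm_sub_reflLast_sq m x y
  simp only [Khalf_eq m _ x y hR]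
  set R := ‖x - reflLast m y‖
  have hle : ‖x - y‖ ≤ R := abs_le_of_sq_le_sq' (by nlinarith [mul_pos hx hy]) hR.le |>.2
  simp only [ite_pow, ne_eq, OfNat.ofNat_ne_zero, not_false_eq_true, zero_pow,
    Finset.sum_ite_eq', Finset.mem_univ, if_true]
  rw [← hI, Real.sqrt_sq (by positivity)]
  have hpow : (R ^ 2) ^ (-((m : ℝ) + 4) / 2) = R⁻¹ * R ^ (-((m : ℝ) + 3)) := by
    rw [← Real.rpow_natCast, ← Real.rpow_mul hR.le, ← Real.rpow_neg_one, ← Real.rpow_add hR]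
    congr 1
    push_cast
    ring
  have hbase : x (Fin.last m) / 2 * (1 + ‖(x (Fin.last m))⁻¹ • (y - x)‖) ≤ R := by
    rw [norm_smul, norm_inv, Real.norm_of_nonneg hx.le, norm_sub_rev]
    field_simp
    linarith
  have hmono : R ^ (-((m : ℝ) + 3)) ≤ (x (Fin.last m) / 2) ^ (-((m : ℝ) + 3)) *
      (1 + ‖(x (Fin.last m))⁻¹ • (y - x)‖) ^ (-((m : ℝ) + 3)) := by
    rw [← Real.mul_rpow (by positivity) (by positivity)]
    exact Real.rpow_le_rpow_of_nonpos (by positivity) hbase (by linarith [m.cast_nonneg (α := ℝ)])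
  have hsR : (x (Fin.last m) + y (Fin.last m)) * R⁻¹ ≤ 1 := by
    rw [← div_eq_mul_inv]
    exact (div_le_one hR).2 hs
  calc _ = (4 * Real.pi) ^ (-((m : ℝ) + 1) / 2) * I *
        (((x (Fin.last m) + y (Fin.last m)) * R⁻¹) * R ^ (-((m : ℝ) + 3))) := by rw [hpow]; ring
    _ ≤ (4 * Real.pi) ^ (-((m : ℝ) + 1) / 2) * I * (1 * ((x (Fin.last m) / 2) ^ (-((m : ℝ) + 3)) *
          (1 + ‖(x (Fin.last m))⁻¹ • (y - x)‖) ^ (-((m : ℝ) + 3)))) := by gcongr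
    _ = _ := by ring

/-- The kernel of the commutator `[∇, Λ]` on the half space satisfies
`∫_{ℝ^d_+} |K(x,y)| dy ≤ C / x_d²`, with `C` depending only on the dimension. -/
theorem halfspace_commutator_kernel_bound (m : ℕ) :
    ∃ C > 0, ∀ x : EuclideanSpace ℝ (Fin (m + 1)), 0 < x (Fin.last m) →
      (∫ y in {y : EuclideanSpace ℝ (Fin (m + 1)) | 0 < y (Fin.last m)},
          Real.sqrt (∑ i, (Khalf m i x y) ^ 2)) ≤ C / (x (Fin.last m)) ^ 2 := by
  set I := ∫ t in Ioi (0 : ℝ), t ^ (-((m : ℝ) + 6) / 2) * Real.exp (-1 / (4 * t)) with hI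
  have hI0 : 0 ≤ I := setIntegral_nonneg measurableSet_Ioi fun t (ht : 0 < t) => by positivity
  let g : EuclideanSpace ℝ (Fin (m + 1)) → ℝ := fun z => (1 + ‖z‖) ^ (-((m : ℝ) + 3))
  have hg0 : ∀ z, 0 ≤ g z := fun z => by positivity
  have hg : Integrable g := integrable_one_add_norm (by
    rw [finrank_euclideanSpace_fin]; push_cast; linarith)
  set D := (4 * Real.pi) ^ (-((m : ℝ) + 1) / 2) * I * 2 ^ ((m : ℝ) + 3) * ∫ z, g z with hD
  have hD0 : 0 ≤ D := by
    have := integral_nonneg (μ := volume) (f := g) (fun z => hg0 z)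
    positivity
  refine ⟨D + 1, by positivity, fun x hx => ?_⟩
  set s := x (Fin.last m) with hs
  set k := (4 * Real.pi) ^ (-((m : ℝ) + 1) / 2) * I * (s / 2) ^ (-((m : ℝ) + 3)) with hk
  have hk0 : 0 ≤ k := by positivity
  have hmeas : MeasurableSet {y : EuclideanSpace ℝ (Fin (m + 1)) | 0 < y (Fin.last m)} :=
    measurableSet_lt measurable_const (by fun_prop)
  have hG : Integrable fun y => k * g (s⁻¹ • (y - x)) :=
    (((integrable_comp_smul_iff volume g (inv_ne_zero hx.ne')).2 hg).comp_sub_right x).const_mul k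
  have hint : ∫ y, k * g (s⁻¹ • (y - x)) = D / s ^ 2 := by
    rw [integral_const_mul, integral_sub_right_eq_self (fun y => g (s⁻¹ • y)) x,
      Measure.integral_comp_smul, inv_pow, inv_inv, finrank_euclideanSpace_fin, hD, hk, Real.div_rpow hx.le zero_le_two,
      Real.rpow_neg hx.le, Real.rpow_neg zero_le_two, abs_of_nonneg (by positivity), smul_eq_mul,
      show ((m : ℝ) + 3) = ((m + 3 : ℕ) : ℝ) by push_cast; rfl, Real.rpow_natCast,
      Real.rpow_natCast]
    field_simp
    ring
  calc _ ≤ ∫ y in {y : EuclideanSpace ℝ (Fin (m + 1)) | 0 < y (Fin.last m)},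
          k * g (s⁻¹ • (y - x)) := by
        refine integral_mono_of_nonneg (Filter.Eventually.of_forall fun y => Real.sqrt_nonneg _)
          hG.integrableOn ?_
        filter_upwards [ae_restrict_mem hmeas] with y hy
        exact sqrt_sum_Khalf_sq_le m x y hx hy
    _ ≤ ∫ y, k * g (s⁻¹ • (y - x)) :=
        setIntegral_le_integral hG (Filter.Eventually.of_forall fun y => mul_nonneg hk0 (hg0 _))
    _ = D / s ^ 2 := hint
    _ ≤ (D + 1) / s ^ 2 := by gcongr; linarith

end
end
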